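/- (Upper bound for the wave speed parameter / lower bound for the Froude number.) Let γ be real, ε₁ > 0 and α > 0. Suppose η, ζ, ϑ : ℝ×[0,1] → ℝ are twice continuously differentiable on the closed strip, harmonic in R, satisfy on Γ: ζ(x,1) = 1 − γ/2 − (γ/2)η(x,1)², (ζ_y + γ η η_y)² + ε₁ ϑ_y² = (1 + ε₁ − 2α(η−1))·(η_x² + η_y²) at every point (x,1), and ϑ(x,1) = 1; satisfy η = ζ = ϑ = 0 on B; satisfy inf over the closed strip of (1 + ε₁ − 2α(η−1))²·(η_x² + η_y²) > 0; and suppose the functions η(x,y) − y, ζ(x,y) − (1−γ)y, ϑ(x,y) − y together with their partial derivatives of order at most 2 tend to 0 uniformly in y ∈ [0,1] as |x| → ∞. If η(x,1) ≥ 1 for all x and η(·,1) is not identically equal to 1, then α < 1 − γ + ε₁. -/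

import Mathlib

/-- The closed strip `ℝ × [0,1]`. -/
def strip : Set (ℝ × ℝ) := {p : ℝ × ℝ | p.2 ∈ Set.Icc (0 : ℝ) 1}

/-- The open strip `R = ℝ × (0,1)`. -/
def stripO : Set (ℝ × ℝ) := {p : ℝ × ℝ | p.2 ∈ Set.Ioo (0 : ℝ) 1}

/-- Partial derivative in the first (horizontal) variable, taken within the closed strip
(at interior points it agrees with the usual partial derivative; on the boundary it is
the one-sided partial derivative). -/
noncomputable def pdx (f : ℝ × ℝ → ℝ) (p : ℝ × ℝ) : ℝ := fderivWithin ℝ f strip p (1, 0)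

/-- Partial derivative in the second (vertical) variable, taken within the closed strip. -/
noncomputable def pdy (f : ℝ × ℝ → ℝ) (p : ℝ × ℝ) : ℝ := fderivWithin ℝ f strip p (0, 1)

open Set Filter Topology MeasureTheory

lemma strip_eq_prod : strip = univ ×ˢ Icc (0 : ℝ) 1 := by
  ext p; simp [strip]

lemma uniqueDiffOn_strip : UniqueDiffOn ℝ strip := by
  rw [strip_eq_prod]
  exact uniqueDiffOn_univ.prod (uniqueDiffOn_Icc zero_lt_one)

lemma stripO_subset_strip : stripO ⊆ strip := fun _ hp => Ioo_subset_Icc_self hp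

lemma strip_mem_nhds {p : ℝ × ℝ} (hp : p ∈ stripO) : strip ∈ 𝓝 p :=
  mem_of_superset ((isOpen_Ioo.preimage continuous_snd).mem_nhds hp) stripO_subset_strip

lemma top_mem_strip (x : ℝ) : (x, (1 : ℝ)) ∈ strip := by simp [strip]

lemma bot_mem_strip (x : ℝ) : (x, (0 : ℝ)) ∈ strip := by simp [strip]

lemma ContDiffOn.pdx {f : ℝ × ℝ → ℝ} {m n : WithTop ℕ∞} (hf : ContDiffOn ℝ n f strip)
    (h : m + 1 ≤ n) : ContDiffOn ℝ m (pdx f) strip :=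
  (hf.fderivWithin uniqueDiffOn_strip h).clm_apply contDiffOn_const

lemma ContDiffOn.pdy {f : ℝ × ℝ → ℝ} {m n : WithTop ℕ∞} (hf : ContDiffOn ℝ n f strip)
    (h : m + 1 ≤ n) : ContDiffOn ℝ m (pdy f) strip :=
  (hf.fderivWithin uniqueDiffOn_strip h).clm_apply contDiffOn_const

lemma hasDerivAt_pdx {f : ℝ × ℝ → ℝ} (hf : ContDiffOn ℝ 1 f strip) {p : ℝ × ℝ}
    (hp : p ∈ strip) : HasDerivAt (fun t => f (t, p.2)) (pdx f p) p.1 := by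
  have h1 : HasFDerivWithinAt f (fderivWithin ℝ f strip p) strip (p.1, p.2) :=
    ((hf.differentiableOn one_ne_zero) p hp).hasFDerivWithinAt
  exact h1.comp_hasDerivAt (f := fun t => (t, p.2)) p.1
    ((hasDerivAt_id p.1).prodMk (hasDerivAt_const p.1 p.2)) (Eventually.of_forall fun _ => hp)

lemma hasDerivAt_pdy {f : ℝ × ℝ → ℝ} (hf : ContDiffOn ℝ 1 f strip) {p : ℝ × ℝ}
    (hp : p ∈ stripO) : HasDerivAt (fun t => f (p.1, t)) (pdy f p) p.2 := by
  have h1 : HasFDerivWithinAt f (fderivWithin ℝ f strip p) strip (p.1, p.2) :=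
    ((hf.differentiableOn one_ne_zero) p (stripO_subset_strip hp)).hasFDerivWithinAt
  exact h1.comp_hasDerivAt (f := fun t => (p.1, t)) p.2
    ((hasDerivAt_const p.2 p.1).prodMk (hasDerivAt_id p.2))
    (mem_of_superset (isOpen_Ioo.mem_nhds hp) fun _ ht => Ioo_subset_Icc_self ht)

lemma pdx_pdy_comm {f : ℝ × ℝ → ℝ} (hf : ContDiffOn ℝ 2 f strip) {p : ℝ × ℝ}
    (hp : p ∈ stripO) : pdx (pdy f) p = pdy (pdx f) p := by
  have hfp : ContDiffAt ℝ 2 f p := hf.contDiffAt (strip_mem_nhds hp)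
  have hs := hfp.isSymmSndFDerivAt (by simp)
  have hd : DifferentiableAt ℝ (fderiv ℝ f) p :=
    (hfp.fderiv_right (m := 1) (by norm_num)).differentiableAt one_ne_zero
  have he : fderivWithin ℝ f strip =ᶠ[𝓝 p] fderiv ℝ f := by
    filter_upwards [(isOpen_Ioo.preimage continuous_snd).mem_nhds hp] with q hq
    exact fderivWithin_of_mem_nhds (strip_mem_nhds hq)
  have key (v : ℝ × ℝ) : fderivWithin ℝ (fun q => fderivWithin ℝ f strip q v) strip p
      = (fderiv ℝ (fderiv ℝ f) p).flip v := by
    rw [fderivWithin_of_mem_nhds (strip_mem_nhds hp)]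
    have h2 : (fun q => fderivWithin ℝ f strip q v) =ᶠ[𝓝 p] fun q => fderiv ℝ f q v :=
      he.mono fun q hq => by simp [hq]
    rw [h2.fderiv_eq]
    ext <;> simp [fderiv_clm_apply hd (differentiableAt_const v)]
  calc pdx (pdy f) p = fderiv ℝ (fderiv ℝ f) p (1, 0) (0, 1) := by
        change fderivWithin ℝ (fun q => fderivWithin ℝ f strip q (0, 1)) strip p (1, 0) = _
        rw [key]; rfl
    _ = fderiv ℝ (fderiv ℝ f) p (0, 1) (1, 0) := hs _ _
    _ = pdy (pdx f) p := by
        change _ = fderivWithin ℝ (fun q => fderivWithin ℝ f strip q (1, 0)) strip p (0, 1)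
        rw [key]; rfl

/-- The two horizontal ends of the closed strip. -/
def stripEnd : Filter (ℝ × ℝ) := comap (fun p => |p.1|) atTop ⊓ 𝓟 strip

lemma eventually_stripEnd {P : ℝ × ℝ → Prop} :
    (∀ᶠ p in stripEnd, P p) ↔ ∃ M : ℝ, ∀ p ∈ strip, M ≤ |p.1| → P p := by
  rw [stripEnd, eventually_inf_principal, eventually_comap, eventually_atTop]
  constructor
  · rintro ⟨M, hM⟩
    exact ⟨M, fun p hp h => hM _ h p rfl hp⟩
  · rintro ⟨M, hM⟩
    exact ⟨M, fun b hb p hpb hp => hM p hp (hpb ▸ hb)⟩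

lemma eventually_mem_strip : ∀ᶠ p in stripEnd, p ∈ strip :=
  eventually_stripEnd.2 ⟨0, fun _ hp _ => hp⟩

/-- A divergence inequality: a `C¹` field with nonnegative divergence, whose horizontal component
decays, cannot have a smaller vertical component on the top than on the bottom unless the two
agree. -/
lemma top_eq_bot_of_div_nonneg {A B : ℝ × ℝ → ℝ} (hA : ContDiffOn ℝ 1 A strip)
    (hB : ContDiffOn ℝ 1 B strip) (hA0 : Tendsto A stripEnd (𝓝 0))
    (hdiv : ∀ p ∈ stripO, 0 ≤ pdx A p + pdy B p) (hle : ∀ x, B (x, 1) ≤ B (x, 0)) (x : ℝ) :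
    B (x, 1) = B (x, 0) := by
  by_contra hne
  set f : ℝ → ℝ := fun t => B (t, 0) - B (t, 1) with hf
  have hBt : Continuous fun t => B (t, 1) :=
    hB.continuousOn.comp_continuous (by fun_prop) top_mem_strip
  have hBb : Continuous fun t => B (t, 0) :=
    hB.continuousOn.comp_continuous (by fun_prop) bot_mem_strip
  have hfc : Continuous f := hBb.sub hBt
  have hf0 : ∀ t, 0 ≤ f t := fun t => sub_nonneg.2 (hle t)
  have hc : 0 < ∫ t in (x - 1)..(x + 1), f t :=
    intervalIntegral.integral_pos (by linarith) hfc.continuousOn (fun t _ => hf0 t)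
      ⟨x, ⟨by linarith, by linarith⟩, lt_of_le_of_ne (hf0 x) fun h => hne (by
        simp only [hf] at h; linarith)⟩
  set c := ∫ t in (x - 1)..(x + 1), f t
  obtain ⟨M₀, hM₀⟩ := eventually_stripEnd.1
    (hA0.eventually (Metric.ball_mem_nhds (0 : ℝ) (show 0 < c / 4 by linarith)))
  set M : ℝ := max |M₀| (|x| + 1)
  have hM1 : M₀ ≤ M := (le_abs_self _).trans (le_max_left _ _)
  have hM2 : |x| + 1 ≤ M := le_max_right _ _
  have hMpos : 0 < M := by have := abs_nonneg x; linarith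
  have hside (s : ℝ) (hs : |s| = M) : |∫ y in (0 : ℝ)..1, A (s, y)| ≤ c / 4 := by
    have := intervalIntegral.norm_integral_le_of_norm_le_const (a := (0 : ℝ)) (b := 1)
      (C := c / 4) (f := fun y => A (s, y)) (fun y hy => by
        rw [uIoc_of_le zero_le_one] at hy
        have h := hM₀ (s, y) ⟨hy.1.le, hy.2⟩ (by simpa [hs] using hM1)
        simpa using (mem_ball_zero_iff.1 h).le)
    simpa using this
  have hsub : uIcc (-M) M ×ˢ uIcc (0 : ℝ) 1 ⊆ strip := by
    rintro ⟨a, b⟩ ⟨-, hb⟩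
    rwa [uIcc_of_le zero_le_one] at hb
  have hdc : ContinuousOn (fun p => pdx A p + pdy B p) strip :=
    ((hA.pdx (m := 0) (by simp)).add (hB.pdy (m := 0) (by simp))).continuousOn
  have hfd {C : ℝ × ℝ → ℝ} (hC : ContDiffOn ℝ 1 C strip) (p : ℝ × ℝ)
      (hp : p ∈ Ioo (min (-M) M) (max (-M) M) ×ˢ Ioo (min (0 : ℝ) 1) (max 0 1) \ ∅) :
      HasFDerivAt C (fderivWithin ℝ C strip p) p := by
    have hp' : p ∈ stripO := by simpa [stripO] using hp.1.2
    exact (hC.differentiableOn one_ne_zero p (stripO_subset_strip hp')).hasFDerivWithinAt.hasFDerivAt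
      (strip_mem_nhds hp')
  have hint := integral2_divergence_prod_of_hasFDerivAt_off_countable A B
    (fderivWithin ℝ A strip) (fderivWithin ℝ B strip) (-M) 0 M 1 ∅ countable_empty
    (hA.continuousOn.mono hsub) (hB.continuousOn.mono hsub) (hfd hA) (hfd hB)
    ((hdc.mono hsub).integrableOn_compact (isCompact_uIcc.prod isCompact_uIcc))
  have hnn : 0 ≤ ∫ s in (-M)..M, ∫ y in (0 : ℝ)..1,
      fderivWithin ℝ A strip (s, y) (1, 0) + fderivWithin ℝ B strip (s, y) (0, 1) := by
    refine intervalIntegral.integral_nonneg (by linarith) fun s _ => ?_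
    rw [intervalIntegral.integral_of_le zero_le_one, integral_Ioc_eq_integral_Ioo]
    exact setIntegral_nonneg measurableSet_Ioo fun y hy => hdiv (s, y) hy
  rw [hint] at hnn
  have h1 := hside M (abs_of_pos hMpos)
  have h2 := hside (-M) (by rw [abs_neg, abs_of_pos hMpos])
  have h3 : c ≤ ∫ t in (-M)..M, f t := by
    refine intervalIntegral.integral_mono_interval ?_ (by linarith) ?_
      (Eventually.of_forall hf0) (hfc.intervalIntegrable _ _)
    · have := neg_abs_le x; linarith
    · have := le_abs_self x; linarith
  have h4 : ∫ t in (-M)..M, f t = (∫ t in (-M)..M, B (t, 0)) - ∫ t in (-M)..M, B (t, 1) :=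
    intervalIntegral.integral_sub (hBb.intervalIntegrable _ _) (hBt.intervalIntegrable _ _)
  have h5 := abs_le.1 h1
  have h6 := abs_le.1 h2
  linarith [h5.2, h6.1]

lemma pdx_congr {f g : ℝ × ℝ → ℝ} (h : EqOn f g strip) {p : ℝ × ℝ} (hp : p ∈ strip) :
    pdx f p = pdx g p := by
  rw [pdx, pdx, fderivWithin_congr h (h hp)]

lemma pdy_congr {f g : ℝ × ℝ → ℝ} (h : EqOn f g strip) {p : ℝ × ℝ} (hp : p ∈ strip) :
    pdy f p = pdy g p := by
  rw [pdy, pdy, fderivWithin_congr h (h hp)]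

lemma fderivWithin_strip_lincomb {f g : ℝ × ℝ → ℝ} (hf : ContDiffOn ℝ 1 f strip)
    (hg : ContDiffOn ℝ 1 g strip) (a b : ℝ) {p : ℝ × ℝ} (hp : p ∈ strip) :
    fderivWithin ℝ (fun q => a * f q + b * g q) strip p
      = a • fderivWithin ℝ f strip p + b • fderivWithin ℝ g strip p :=
  ((((hf.differentiableOn one_ne_zero) p hp).hasFDerivWithinAt.const_mul a).add
    (((hg.differentiableOn one_ne_zero) p hp).hasFDerivWithinAt.const_mul b)).fderivWithin
    (uniqueDiffOn_strip p hp)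

lemma pdx_lincomb {f g : ℝ × ℝ → ℝ} (hf : ContDiffOn ℝ 1 f strip)
    (hg : ContDiffOn ℝ 1 g strip) (a b : ℝ) {p : ℝ × ℝ} (hp : p ∈ strip) :
    pdx (fun q => a * f q + b * g q) p = a * pdx f p + b * pdx g p := by
  simp [pdx, fderivWithin_strip_lincomb hf hg a b hp]

lemma pdy_lincomb {f g : ℝ × ℝ → ℝ} (hf : ContDiffOn ℝ 1 f strip)
    (hg : ContDiffOn ℝ 1 g strip) (a b : ℝ) {p : ℝ × ℝ} (hp : p ∈ strip) :
    pdy (fun q => a * f q + b * g q) p = a * pdy f p + b * pdy g p := by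
  simp [pdy, fderivWithin_strip_lincomb hf hg a b hp]

/-- Harmonic functions on the strip, `C²` up to the boundary, which are asymptotic in `C¹` to
the linear profile `c * y` at both ends. -/
structure IsLaminar (u : ℝ × ℝ → ℝ) (c : ℝ) : Prop where
  smooth : ContDiffOn ℝ 2 u strip
  harmonic : ∀ p ∈ stripO, pdx (pdx u) p + pdy (pdy u) p = 0
  lim : Tendsto (fun p => u p - c * p.2) stripEnd (𝓝 0)
  limx : Tendsto (pdx u) stripEnd (𝓝 0)
  limy : Tendsto (pdy u) stripEnd (𝓝 c)

namespace IsLaminar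

variable {u v : ℝ × ℝ → ℝ} {b c : ℝ}

lemma smooth_one (hu : IsLaminar u c) : ContDiffOn ℝ 1 u strip := hu.smooth.of_le one_le_two

lemma smooth_x (hu : IsLaminar u c) : ContDiffOn ℝ 1 (pdx u) strip :=
  hu.smooth.pdx one_add_one_eq_two.le

lemma smooth_y (hu : IsLaminar u c) : ContDiffOn ℝ 1 (pdy u) strip :=
  hu.smooth.pdy one_add_one_eq_two.le

lemma pdy_pdy (hu : IsLaminar u c) {p : ℝ × ℝ} (hp : p ∈ stripO) :
    pdy (pdy u) p = - pdx (pdx u) p := by linarith [hu.harmonic p hp]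

lemma lincomb (hu : IsLaminar u b) (hv : IsLaminar v c) (s t : ℝ) :
    IsLaminar (fun q => s * u q + t * v q) (s * b + t * c) where
  smooth := (contDiffOn_const.mul hu.smooth).add (contDiffOn_const.mul hv.smooth)
  harmonic p hp := by
    have hp' := stripO_subset_strip hp
    rw [pdx_congr (fun q hq => pdx_lincomb hu.smooth_one hv.smooth_one s t hq) hp',
      pdy_congr (fun q hq => pdy_lincomb hu.smooth_one hv.smooth_one s t hq) hp',
      pdx_lincomb hu.smooth_x hv.smooth_x s t hp', pdy_lincomb hu.smooth_y hv.smooth_y s t hp',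
      hu.pdy_pdy hp, hv.pdy_pdy hp]
    ring
  lim := by
    have := (hu.lim.const_mul s).add (hv.lim.const_mul t)
    simp only [mul_zero, add_zero] at this
    exact this.congr fun p => by ring
  limx := by
    have := (hu.limx.const_mul s).add (hv.limx.const_mul t)
    simp only [mul_zero, add_zero] at this
    exact this.congr' (eventually_mem_strip.mono fun p hp =>
      (pdx_lincomb hu.smooth_one hv.smooth_one s t hp).symm)
  limy := ((hu.limy.const_mul s).add (hv.limy.const_mul t)).congr'
    (eventually_mem_strip.mono fun p hp =>
      (pdy_lincomb hu.smooth_one hv.smooth_one s t hp).symm)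

lemma isBoundedUnder (hu : IsLaminar u c) :
    IsBoundedUnder (· ≤ ·) stripEnd ((fun x => ‖x‖) ∘ u) := by
  refine ⟨1 + |c|, eventually_map.2 ?_⟩
  filter_upwards [hu.lim.eventually (Metric.ball_mem_nhds (0 : ℝ) one_pos), eventually_mem_strip]
    with p hp hs
  have h1 : |u p - c * p.2| < 1 := by simpa using mem_ball_zero_iff.1 hp
  have h2 : |c * p.2| ≤ |c| := by
    rw [abs_mul, abs_of_nonneg hs.1]
    exact mul_le_of_le_one_right (abs_nonneg c) hs.2
  have h3 := abs_add_le (u p - c * p.2) (c * p.2)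
  simp only [sub_add_cancel] at h3
  simp only [Function.comp_apply, Real.norm_eq_abs]
  linarith

lemma tendsto_mul {f : ℝ × ℝ → ℝ} (hu : IsLaminar u c) (hf : Tendsto f stripEnd (𝓝 0)) :
    Tendsto (fun p => u p * f p) stripEnd (𝓝 0) :=
  (hf.zero_mul_isBoundedUnder_le hu.isBoundedUnder).congr fun _ => mul_comm _ _

end IsLaminar

lemma pdx_snd {p : ℝ × ℝ} (hp : p ∈ strip) : pdx (fun q => q.2) p = 0 := by
  simp [pdx, (hasFDerivWithinAt_snd (𝕜 := ℝ) (p := p) (s := strip)).fderivWithin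
    (uniqueDiffOn_strip p hp)]

lemma pdy_snd {p : ℝ × ℝ} (hp : p ∈ strip) : pdy (fun q => q.2) p = 1 := by
  simp [pdy, (hasFDerivWithinAt_snd (𝕜 := ℝ) (p := p) (s := strip)).fderivWithin
    (uniqueDiffOn_strip p hp)]

lemma isLaminar_snd : IsLaminar (fun q => q.2) 1 where
  smooth := contDiffOn_snd
  harmonic p hp := by
    have hp' := stripO_subset_strip hp
    rw [pdx_congr (g := fun _ => 0) (fun q hq => pdx_snd hq) hp',
      pdy_congr (g := fun _ => 1) (fun q hq => pdy_snd hq) hp']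
    simp [pdx, pdy]
  lim := by simpa using tendsto_const_nhds
  limx := tendsto_const_nhds.congr' (eventually_mem_strip.mono fun p hp => (pdx_snd hp).symm)
  limy := tendsto_const_nhds.congr' (eventually_mem_strip.mono fun p hp => (pdy_snd hp).symm)

/-- A `C¹` field `(A, B)` on the closed strip with divergence `d` in the open strip and decaying
horizontal component. -/
structure IsFlux (A B d : ℝ × ℝ → ℝ) : Prop where
  smooth_fst : ContDiffOn ℝ 1 A strip
  smooth_snd : ContDiffOn ℝ 1 B strip
  div : ∀ p ∈ stripO, pdx A p + pdy B p = d p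
  decay : Tendsto A stripEnd (𝓝 0)

lemma IsFlux.lincomb {A B d A' B' d' : ℝ × ℝ → ℝ} (h : IsFlux A B d) (h' : IsFlux A' B' d')
    (s t : ℝ) : IsFlux (fun p => s * A p + t * A' p) (fun p => s * B p + t * B' p)
      (fun p => s * d p + t * d' p) where
  smooth_fst := (contDiffOn_const.mul h.smooth_fst).add (contDiffOn_const.mul h'.smooth_fst)
  smooth_snd := (contDiffOn_const.mul h.smooth_snd).add (contDiffOn_const.mul h'.smooth_snd)
  div p hp := by
    have hp' := stripO_subset_strip hp
    rw [pdx_lincomb h.smooth_fst h'.smooth_fst s t hp',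
      pdy_lincomb h.smooth_snd h'.smooth_snd s t hp', ← h.div p hp, ← h'.div p hp]
    ring
  decay := by simpa using (h.decay.const_mul s).add (h'.decay.const_mul t)

/-- To compute the divergence of a field it is enough to differentiate along coordinate lines. -/
lemma IsFlux.of_hasDerivAt {A B d : ℝ × ℝ → ℝ} (hA : ContDiffOn ℝ 1 A strip)
    (hB : ContDiffOn ℝ 1 B strip) (hdecay : Tendsto A stripEnd (𝓝 0))
    (h : ∀ p ∈ stripO, ∃ a b, HasDerivAt (fun t => A (t, p.2)) a p.1 ∧
      HasDerivAt (fun t => B (p.1, t)) b p.2 ∧ a + b = d p) : IsFlux A B d where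
  smooth_fst := hA
  smooth_snd := hB
  decay := hdecay
  div p hp := by
    obtain ⟨a, b, ha, hb, hab⟩ := h p hp
    rw [(hasDerivAt_pdx hA (stripO_subset_strip hp)).unique ha, (hasDerivAt_pdy hB hp).unique hb,
      hab]

section Fields

variable {u v : ℝ × ℝ → ℝ} {b c : ℝ}

lemma IsLaminar.isFlux_gradient (hu : IsLaminar u c) : IsFlux (pdx u) (pdy u) (fun _ => 0) where
  smooth_fst := hu.smooth_x
  smooth_snd := hu.smooth_y
  div := hu.harmonic
  decay := hu.limx

lemma IsLaminar.isFlux_green (hu : IsLaminar u b) (hv : IsLaminar v c) :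
    IsFlux (fun p => u p * pdx v p - v p * pdx u p) (fun p => u p * pdy v p - v p * pdy u p)
      (fun _ => 0) := by
  refine .of_hasDerivAt ((hu.smooth_one.mul hv.smooth_x).sub (hv.smooth_one.mul hu.smooth_x))
    ((hu.smooth_one.mul hv.smooth_y).sub (hv.smooth_one.mul hu.smooth_y))
    (by simpa using (hu.tendsto_mul hv.limx).sub (hv.tendsto_mul hu.limx)) fun p hp => ?_
  have hp' := stripO_subset_strip hp
  refine ⟨_, _, ((hasDerivAt_pdx hu.smooth_one hp').mul (hasDerivAt_pdx hv.smooth_x hp')).sub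
    ((hasDerivAt_pdx hv.smooth_one hp').mul (hasDerivAt_pdx hu.smooth_x hp')),
    ((hasDerivAt_pdy hu.smooth_one hp).mul (hasDerivAt_pdy hv.smooth_y hp)).sub
    ((hasDerivAt_pdy hv.smooth_one hp).mul (hasDerivAt_pdy hu.smooth_y hp)), ?_⟩
  rw [hu.pdy_pdy hp, hv.pdy_pdy hp]
  ring

/-- The field whose flux compares the normal derivative on the bottom with the trace on the top. -/
lemma IsLaminar.isFlux_lift (hu : IsLaminar u c) :
    IsFlux (fun p => (1 - p.2) * pdx u p) (fun p => (1 - p.2) * pdy u p + u p) (fun _ => 0) := by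
  have hy : ContDiffOn ℝ 1 (fun p : ℝ × ℝ => 1 - p.2) strip := contDiffOn_const.sub contDiffOn_snd
  refine .of_hasDerivAt (hy.mul hu.smooth_x) ((hy.mul hu.smooth_y).add hu.smooth_one) ?_
    fun p hp => ?_
  · simpa [sub_mul] using hu.limx.sub (isLaminar_snd.tendsto_mul hu.limx)
  · have hp' := stripO_subset_strip hp
    refine ⟨_, _, (hasDerivAt_pdx hu.smooth_x hp').const_mul (1 - p.2),
      (((hasDerivAt_id p.2).const_sub 1).mul (hasDerivAt_pdy hu.smooth_y hp)).add
      (hasDerivAt_pdy hu.smooth_one hp), ?_⟩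
    rw [hu.pdy_pdy hp]
    simp

/-- The field expressing that the Dirichlet energy of `u` controls the `L²` norm of its trace on
the top. -/
lemma IsLaminar.isFlux_energy (hu : IsLaminar u c) :
    IsFlux (fun p => u p * pdx u p)
      (fun p => u p * pdy u p - 2 * u (p.1, 1) * u p + u (p.1, 1) ^ 2 * p.2)
      (fun p => pdx u p ^ 2 + (pdy u p - u (p.1, 1)) ^ 2) := by
  have ht : ContDiffOn ℝ 1 (fun p : ℝ × ℝ => u (p.1, 1)) strip :=
    hu.smooth_one.comp (contDiff_fst.prodMk contDiff_const).contDiffOn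
      fun p _ => top_mem_strip p.1
  refine .of_hasDerivAt (hu.smooth_one.mul hu.smooth_x)
    (((hu.smooth_one.mul hu.smooth_y).sub ((contDiffOn_const.mul ht).mul hu.smooth_one)).add
      ((ht.pow 2).mul contDiffOn_snd)) (hu.tendsto_mul hu.limx) fun p hp => ?_
  have hp' := stripO_subset_strip hp
  refine ⟨_, _, (hasDerivAt_pdx hu.smooth_one hp').mul (hasDerivAt_pdx hu.smooth_x hp'),
    (((hasDerivAt_pdy hu.smooth_one hp).mul (hasDerivAt_pdy hu.smooth_y hp)).sub
      ((hasDerivAt_pdy hu.smooth_one hp).const_mul (2 * u (p.1, 1)))).add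
      ((hasDerivAt_id p.2).const_mul (u (p.1, 1) ^ 2)), ?_⟩
  rw [hu.pdy_pdy hp]
  ring

/-- A combination of the energy and Rellich fields. -/
lemma IsLaminar.isFlux_rellich (hu : IsLaminar u c) :
    IsFlux (fun p => u p * pdx u p - 2 * (p.2 * (pdx u p * pdy u p)))
      (fun p => u p * pdy u p - p.2 * (pdy u p ^ 2 - pdx u p ^ 2))
      (fun p => 2 * pdx u p ^ 2) := by
  refine .of_hasDerivAt ((hu.smooth_one.mul hu.smooth_x).sub
    (contDiffOn_const.mul (contDiffOn_snd.mul (hu.smooth_x.mul hu.smooth_y))))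
    ((hu.smooth_one.mul hu.smooth_y).sub
      (contDiffOn_snd.mul ((hu.smooth_y.pow 2).sub (hu.smooth_x.pow 2)))) ?_ fun p hp => ?_
  · have h := isLaminar_snd.tendsto_mul (by simpa using hu.limx.mul hu.limy)
    simpa using (hu.tendsto_mul hu.limx).sub (h.const_mul 2)
  have hp' := stripO_subset_strip hp
  refine ⟨_, _, ((hasDerivAt_pdx hu.smooth_one hp').mul (hasDerivAt_pdx hu.smooth_x hp')).sub
      ((((hasDerivAt_pdx hu.smooth_x hp').mul (hasDerivAt_pdx hu.smooth_y hp')).const_mul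
        p.2).const_mul 2),
    ((hasDerivAt_pdy hu.smooth_one hp).mul (hasDerivAt_pdy hu.smooth_y hp)).sub
      ((hasDerivAt_id p.2).mul (((hasDerivAt_pdy hu.smooth_y hp).pow 2).sub
        ((hasDerivAt_pdy hu.smooth_x hp).pow 2))), ?_⟩
  rw [hu.pdy_pdy hp, pdx_pdy_comm hu.smooth hp]
  simp
  ring

/-- The field formed by the imaginary and real parts of the holomorphic function
`(v_y + i v_x)² / (u_y + i u_x)`. -/
lemma IsLaminar.isFlux_quotient (hu : IsLaminar u b) (hv : IsLaminar v c) (hb : b ≠ 0)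
    (hne : ∀ p ∈ strip, pdx u p ^ 2 + pdy u p ^ 2 ≠ 0) :
    IsFlux
      (fun p => (2 * (pdx v p * pdy v p) * pdy u p - (pdy v p ^ 2 - pdx v p ^ 2) * pdx u p)
        / (pdx u p ^ 2 + pdy u p ^ 2))
      (fun p => ((pdy v p ^ 2 - pdx v p ^ 2) * pdy u p + 2 * (pdx v p * pdy v p) * pdx u p)
        / (pdx u p ^ 2 + pdy u p ^ 2))
      (fun _ => 0) := by
  have hN := (hu.smooth_x.pow 2).add (hu.smooth_y.pow 2)
  have h1 := (contDiffOn_const (c := (2 : ℝ))).mul (hv.smooth_x.mul hv.smooth_y)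
  have h2 := (hv.smooth_y.pow 2).sub (hv.smooth_x.pow 2)
  refine .of_hasDerivAt (((h1.mul hu.smooth_y).sub (h2.mul hu.smooth_x)).div hN hne)
    (((h2.mul hu.smooth_y).add (h1.mul hu.smooth_x)).div hN hne) ?_ fun p hp => ?_
  · have hn : (0 : ℝ) ^ 2 + b ^ 2 ≠ 0 := by positivity
    simpa [Pi.div_def] using (((((hv.limx.mul hv.limy).const_mul 2).mul hu.limy).sub
      (((hv.limy.pow 2).sub (hv.limx.pow 2)).mul hu.limx)).div
        ((hu.limx.pow 2).add (hu.limy.pow 2)) hn)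
  have hp' := stripO_subset_strip hp
  have xx := hasDerivAt_pdx hu.smooth_x hp'
  have xy := hasDerivAt_pdx hu.smooth_y hp'
  have vxx := hasDerivAt_pdx hv.smooth_x hp'
  have vxy := hasDerivAt_pdx hv.smooth_y hp'
  have yx := hasDerivAt_pdy hu.smooth_x hp
  have yy := hasDerivAt_pdy hu.smooth_y hp
  have vyx := hasDerivAt_pdy hv.smooth_x hp
  have vyy := hasDerivAt_pdy hv.smooth_y hp
  have hn := hne p hp'
  refine ⟨_, _, (((((vxx.mul vxy).const_mul 2).mul xy).sub
      (((vxy.pow 2).sub (vxx.pow 2)).mul xx)).div ((xx.pow 2).add (xy.pow 2)) hn),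
    (((((vyy.pow 2).sub (vyx.pow 2)).mul yy).add (((vyx.mul vyy).const_mul 2).mul yx)).div
      ((yx.pow 2).add (yy.pow 2)) hn), ?_⟩
  rw [hu.pdy_pdy hp, hv.pdy_pdy hp, pdx_pdy_comm hu.smooth hp, pdx_pdy_comm hv.smooth hp]
  simp only [Pi.add_apply, Pi.sub_apply, Pi.mul_apply, Pi.pow_apply, Prod.mk.eta]
  rw [← add_div, div_eq_zero_iff]
  left
  push_cast
  ring

end Fields

lemma isLaminar_of_decay {u : ℝ × ℝ → ℝ} {c : ℝ} (hu : ContDiffOn ℝ 2 u strip)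
    (hharm : ∀ p ∈ stripO, pdx (pdx u) p + pdy (pdy u) p = 0)
    (hdecay : ∀ ε > (0 : ℝ), ∃ M : ℝ, ∀ p ∈ strip, M ≤ |p.1| → ∀ n : ℕ, n ≤ 2 →
      ‖iteratedFDerivWithin ℝ n (fun q : ℝ × ℝ => u q - c * q.2) strip p‖ < ε) :
    IsLaminar u c := by
  have hu1 : ContDiffOn ℝ 1 u strip := hu.of_le one_le_two
  have hlin : (fun q : ℝ × ℝ => u q - c * q.2) = fun q => 1 * u q + (-c) * q.2 := by
    ext q; ring
  have hsmall (n : ℕ) (hn : n ≤ 2) (ε : ℝ) (hε : 0 < ε) : ∀ᶠ p in stripEnd, p ∈ strip ∧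
      ‖iteratedFDerivWithin ℝ n (fun q : ℝ × ℝ => u q - c * q.2) strip p‖ < ε := by
    obtain ⟨M, hM⟩ := hdecay ε hε
    exact eventually_stripEnd.2 ⟨M, fun p hp h => ⟨hp, hM p hp h n hn⟩⟩
  have hD : Tendsto (fderivWithin ℝ (fun q : ℝ × ℝ => u q - c * q.2) strip) stripEnd (𝓝 0) := by
    refine Metric.tendsto_nhds.2 fun ε hε => (hsmall 1 one_le_two ε hε).mono fun p hp => ?_
    rw [dist_zero_right, ← norm_iteratedFDerivWithin_one _ (uniqueDiffOn_strip p hp.1)]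
    exact hp.2
  have hDv (v : ℝ × ℝ) : Tendsto
      (fun p => fderivWithin ℝ (fun q : ℝ × ℝ => u q - c * q.2) strip p v) stripEnd (𝓝 0) := by
    simpa [Function.comp_def] using ((ContinuousLinearMap.apply ℝ ℝ v).continuous.tendsto 0).comp hD
  refine ⟨hu, hharm, ?_, ?_, ?_⟩
  · refine Metric.tendsto_nhds.2 fun ε hε => (hsmall 0 zero_le_two ε hε).mono fun p hp => ?_
    simpa [norm_iteratedFDerivWithin_zero] using hp.2
  · refine (hDv (1, 0)).congr' (eventually_mem_strip.mono fun p hp => ?_)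
    change pdx _ p = _
    rw [hlin, pdx_lincomb hu1 isLaminar_snd.smooth_one _ _ hp, pdx_snd hp]
    ring
  · have h := (hDv (0, 1)).add_const c
    rw [zero_add] at h
    refine h.congr' (eventually_mem_strip.mono fun p hp => ?_)
    change pdy _ p + c = _
    rw [hlin, pdy_lincomb hu1 isLaminar_snd.smooth_one _ _ hp, pdy_snd hp]
    ring

lemma pdx_eq_of_trace {u : ℝ × ℝ → ℝ} (hu : ContDiffOn ℝ 1 u strip) {g : ℝ → ℝ} {g' x y : ℝ}
    (hp : (x, y) ∈ strip) (hg : HasDerivAt g g' x) (h : ∀ t, u (t, y) = g t) :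
    pdx u (x, y) = g' := by
  have h1 : HasDerivAt (fun t => u (t, y)) (pdx u (x, y)) x := hasDerivAt_pdx hu hp
  rw [funext h] at h1
  exact h1.unique hg

/-- A laminar harmonic function with boundary values `0` and `1` has normal derivative `1` on the
top. -/
lemma IsLaminar.pdy_top_eq_one {u : ℝ × ℝ → ℝ} (hu : IsLaminar u 1) (htop : ∀ x, u (x, 1) = 1)
    (hbot : ∀ x, u (x, 0) = 0) (x : ℝ) : pdy u (x, 1) = 1 := by
  have hv := hu.lincomb isLaminar_snd 1 (-1)
  have hF := hv.isFlux_rellich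
  set v : ℝ × ℝ → ℝ := fun q => 1 * u q + (-1) * q.2 with hvdef
  have hv1 (t : ℝ) : v (t, 1) = 0 := by simp [hvdef, htop]
  have hx (t : ℝ) : pdx v (t, 1) = 0 :=
    pdx_eq_of_trace hv.smooth_one (top_mem_strip t) (hasDerivAt_const t 0) hv1
  have hy : pdy v (x, 1) = pdy u (x, 1) - 1 := by
    rw [hvdef, pdy_lincomb hu.smooth_one isLaminar_snd.smooth_one _ _ (top_mem_strip x),
      pdy_snd (top_mem_strip x)]
    ring
  have h := top_eq_bot_of_div_nonneg hF.smooth_fst hF.smooth_snd hF.decay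
    (fun p hp => by rw [hF.div p hp]; positivity)
    (fun t => by simp only [htop, hbot, hx]; nlinarith [sq_nonneg (pdy v (t, 1))]) x
  simp only [htop, hbot, hx, hy] at h
  have h2 : (pdy u (x, 1) - 1) ^ 2 = 0 := by linarith
  linarith [pow_eq_zero_iff (two_ne_zero) |>.1 h2]

lemma IsLaminar.pdy_bot_pos {u : ℝ × ℝ → ℝ} {c : ℝ} (hu : IsLaminar u c) (hc : 0 < c)
    (hne : ∀ x, pdy u (x, 0) ≠ 0) (x : ℝ) : 0 < pdy u (x, 0) := by
  have hcont : Continuous fun t => pdy u (t, 0) :=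
    hu.smooth_y.continuousOn.comp_continuous (by fun_prop) bot_mem_strip
  obtain ⟨M, hM⟩ := eventually_stripEnd.1 (hu.limy.eventually_const_lt hc)
  have hpos := hM (M, 0) (bot_mem_strip M) (le_abs_self M)
  by_contra! hx
  obtain ⟨t, -, ht⟩ := isPreconnected_univ.intermediate_value (mem_univ x) (mem_univ M)
    hcont.continuousOn ⟨hx, hpos.le⟩
  exact hne t ht

/-- Upper bound for the wave speed parameter (lower bound for the Froude number): if
`(η, ζ, ϑ)` solves the conformally mapped electrohydrodynamic system on the strip
(harmonic in `R`, boundary conditions on `Γ` and `B`, uniform non-degeneracy,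
and decay to the trivial laminar flow together with all partial derivatives of order
at most `2`, uniformly in `y`, as `|x| → ∞`), and if the surface profile satisfies
`η(x,1) ≥ 1` for all `x` but `η(·,1) ≢ 1`, then `α < 1 − γ + ε₁`. -/
theorem stmt_15 (γ ε₁ α : ℝ) (hε₁ : 0 < ε₁) (hα : 0 < α)
    (η ζ ϑ : ℝ × ℝ → ℝ)
    (hηC : ContDiffOn ℝ 2 η strip) (hζC : ContDiffOn ℝ 2 ζ strip)
    (hϑC : ContDiffOn ℝ 2 ϑ strip)
    (hηH : ∀ p ∈ stripO, pdx (pdx η) p + pdy (pdy η) p = 0)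
    (hζH : ∀ p ∈ stripO, pdx (pdx ζ) p + pdy (pdy ζ) p = 0)
    (hϑH : ∀ p ∈ stripO, pdx (pdx ϑ) p + pdy (pdy ϑ) p = 0)
    (hΓ1 : ∀ x : ℝ, ζ (x, 1) = 1 - γ / 2 - (γ / 2) * (η (x, 1)) ^ 2)
    (hΓ2 : ∀ x : ℝ,
      (pdy ζ (x, 1) + γ * η (x, 1) * pdy η (x, 1)) ^ 2 + ε₁ * (pdy ϑ (x, 1)) ^ 2
        = (1 + ε₁ - 2 * α * (η (x, 1) - 1))
            * ((pdx η (x, 1)) ^ 2 + (pdy η (x, 1)) ^ 2))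
    (hΓ3 : ∀ x : ℝ, ϑ (x, 1) = 1)
    (hB : ∀ x : ℝ, η (x, 0) = 0 ∧ ζ (x, 0) = 0 ∧ ϑ (x, 0) = 0)
    (hinf : ∃ δ > 0, ∀ p ∈ strip,
      δ ≤ (1 + ε₁ - 2 * α * (η p - 1)) ^ 2 * ((pdx η p) ^ 2 + (pdy η p) ^ 2))
    (hdecay : ∀ ε > (0 : ℝ), ∃ M : ℝ, ∀ p ∈ strip, M ≤ |p.1| →
      ∀ n : ℕ, n ≤ 2 →
        ‖iteratedFDerivWithin ℝ n (fun q : ℝ × ℝ => η q - q.2) strip p‖ < ε ∧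
        ‖iteratedFDerivWithin ℝ n (fun q : ℝ × ℝ => ζ q - (1 - γ) * q.2) strip p‖ < ε ∧
        ‖iteratedFDerivWithin ℝ n (fun q : ℝ × ℝ => ϑ q - q.2) strip p‖ < ε)
    (helev : ∀ x : ℝ, 1 ≤ η (x, 1))
    (hnontriv : ∃ x : ℝ, η (x, 1) ≠ 1) :
    α < 1 - γ + ε₁ := by
  have hη : IsLaminar η 1 := isLaminar_of_decay hηC hηH fun ε hε => by
    obtain ⟨M, hM⟩ := hdecay ε hε
    exact ⟨M, fun p hp h n hn => by simpa using (hM p hp h n hn).1⟩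
  have hζ : IsLaminar ζ (1 - γ) := isLaminar_of_decay hζC hζH fun ε hε => by
    obtain ⟨M, hM⟩ := hdecay ε hε
    exact ⟨M, fun p hp h n hn => (hM p hp h n hn).2.1⟩
  have hϑ : IsLaminar ϑ 1 := isLaminar_of_decay hϑC hϑH fun ε hε => by
    obtain ⟨M, hM⟩ := hdecay ε hε
    exact ⟨M, fun p hp h n hn => by simpa using (hM p hp h n hn).2.2⟩
  have hϑy := hϑ.pdy_top_eq_one hΓ3 fun x => (hB x).2.2
  have hN : ∀ p ∈ strip, pdx η p ^ 2 + pdy η p ^ 2 ≠ 0 := by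
    obtain ⟨δ, hδ, h⟩ := hinf
    intro p hp h0
    have := h p hp
    rw [h0, mul_zero] at this
    linarith
  have hη0 (x : ℝ) : pdx η (x, 0) = 0 :=
    pdx_eq_of_trace hη.smooth_one (bot_mem_strip x) (hasDerivAt_const x 0) fun t => (hB t).1
  have hζ0 (x : ℝ) : pdx ζ (x, 0) = 0 :=
    pdx_eq_of_trace hζ.smooth_one (bot_mem_strip x) (hasDerivAt_const x 0) fun t => (hB t).2.1
  have hζ1 (x : ℝ) : pdx ζ (x, 1) = -γ * η (x, 1) * pdx η (x, 1) :=
    pdx_eq_of_trace hζ.smooth_one (top_mem_strip x)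
      (by
        have h1 : HasDerivAt (fun t => η (t, 1)) (pdx η (x, 1)) x :=
          hasDerivAt_pdx hη.smooth_one (top_mem_strip x)
        refine (((h1.pow 2).const_mul (γ / 2)).const_sub (1 - γ / 2)).congr_deriv ?_
        push_cast
        ring) hΓ1
  have hpos := hη.pdy_bot_pos one_pos fun x h => hN _ (bot_mem_strip x) (by simp [hη0, h])
  have hw := hη.lincomb isLaminar_snd 1 (-1)
  have hv := hζ.lincomb isLaminar_snd 1 (-(1 - γ))
  have hwy {p : ℝ × ℝ} (hp : p ∈ strip) := pdy_lincomb hη.smooth_one isLaminar_snd.smooth_one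
    1 (-1) hp
  have hvy {p : ℝ × ℝ} (hp : p ∈ strip) := pdy_lincomb hζ.smooth_one isLaminar_snd.smooth_one
    1 (-(1 - γ)) hp
  have hF := (((((((hη.isFlux_quotient hζ one_ne_zero hN).lincomb
    (hη.isFlux_quotient isLaminar_snd one_ne_zero hN) 1 ε₁).lincomb
    (hη.isFlux_green hζ) 1 (2 * γ)).lincomb
    hη.isFlux_gradient 1 (-((1 - γ) ^ 2 + ε₁))).lincomb
    hv.isFlux_lift 1 (-(2 * (1 - γ)))).lincomb
    hw.isFlux_lift 1 (2 * ((1 - γ) ^ 2 + ε₁))).lincomb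
    hw.isFlux_energy 1 (2 * α))
  by_contra! hge
  have hc : 0 < 2 * α - γ * (1 - γ) := by
    rcases le_or_gt (γ * (1 - γ)) 0 with h | h
    · linarith
    · nlinarith [sq_nonneg γ, sq_nonneg (1 - γ)]
  have hgap (x : ℝ) : 0 ≤ 2 * (α - (1 - γ + ε₁)) * (η (x, 1) - 1)
      + (2 * α - γ * (1 - γ)) * (η (x, 1) - 1) ^ 2 := by
    have h1 : 0 ≤ α - (1 - γ + ε₁) := sub_nonneg.2 hge
    have h2 : 0 ≤ η (x, 1) - 1 := sub_nonneg.2 (helev x)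
    positivity
  have htop (x : ℝ) :
      ((pdy ζ (x, 1) ^ 2 - pdx ζ (x, 1) ^ 2) * pdy η (x, 1)
          + 2 * (pdx ζ (x, 1) * pdy ζ (x, 1)) * pdx η (x, 1))
          / (pdx η (x, 1) ^ 2 + pdy η (x, 1) ^ 2)
        + ε₁ * (pdy η (x, 1) / (pdx η (x, 1) ^ 2 + pdy η (x, 1) ^ 2))
      = (1 + ε₁ - 2 * α * (η (x, 1) - 1)) * pdy η (x, 1) - 2 * γ * η (x, 1) * pdy ζ (x, 1)
        - γ ^ 2 * η (x, 1) ^ 2 * pdy η (x, 1) := by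
    have hn := hN _ (top_mem_strip x)
    have hdyn := hΓ2 x
    rw [hϑy] at hdyn
    rw [hζ1, ← mul_div_assoc, ← add_div, div_eq_iff hn]
    linear_combination (pdy η (x, 1)) * hdyn
  have hbot (x : ℝ) : 0 ≤ pdy ζ (x, 0) ^ 2 * pdy η (x, 0) / pdy η (x, 0) ^ 2
      + ε₁ * (pdy η (x, 0) / pdy η (x, 0) ^ 2) - ((1 - γ) ^ 2 + ε₁) * pdy η (x, 0)
      - 2 * (1 - γ) * (pdy ζ (x, 0) - (1 - γ))
      + 2 * ((1 - γ) ^ 2 + ε₁) * (pdy η (x, 0) - 1) := by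
    have ha := hpos x
    have : 0 ≤ (pdy ζ (x, 0) - (1 - γ) * pdy η (x, 0)) ^ 2 / pdy η (x, 0)
        + ε₁ * ((1 - pdy η (x, 0)) ^ 2 / pdy η (x, 0)) := by positivity
    refine this.trans_eq ?_
    field_simp
    ring
  have key := top_eq_bot_of_div_nonneg hF.smooth_fst hF.smooth_snd hF.decay
    (fun p hp => by
      rw [hF.div p hp]
      simp only [mul_zero, zero_add, add_zero]
      positivity)
  simp only [hwy (top_mem_strip _), hvy (top_mem_strip _), hwy (bot_mem_strip _),
    hvy (bot_mem_strip _), pdx_snd (top_mem_strip _), pdx_snd (bot_mem_strip _),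
    pdy_snd (top_mem_strip _), pdy_snd (bot_mem_strip _), (hB _).1, (hB _).2.1, hη0, hζ0] at key
  obtain ⟨x, hx⟩ := hnontriv
  have heq := key (fun t => by
    linear_combination htop t + hgap t + hbot t
      + (-2 * γ * pdy η (t, 1) - 2 * (1 - γ)) * hΓ1 t) x
  have hpow : 0 < (η (x, 1) - 1) ^ 2 := by
    have := sub_ne_zero.2 hx
    positivity
  have hlin : 0 ≤ 2 * (α - (1 - γ + ε₁)) * (η (x, 1) - 1) :=
    mul_nonneg (by linarith) (sub_nonneg.2 (helev x))
  have hzero : 2 * (α - (1 - γ + ε₁)) * (η (x, 1) - 1)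
      + (2 * α - γ * (1 - γ)) * (η (x, 1) - 1) ^ 2 ≤ 0 := by
    linear_combination htop x - heq + hbot x
      + (-2 * γ * pdy η (x, 1) - 2 * (1 - γ)) * hΓ1 x
  linarith [mul_pos hc hpow]
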